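/- arXiv:2409.07379 — 2 statements merged into one kernel-verified Lean document; each statement's English description precedes it below -/
import Mathlib

section
/- For any p×p real symmetric positive semidefinite matrices A and B, ⟨(I + B)⁻¹, A⟩ ≥ Tr(A) / (1 + Tr(B)), i.e., Tr((I + B)⁻¹ A) ≥ Tr(A)/(1 + Tr(B)). (Note I + B is invertible since B is positive semidefinite.) -/
open Matrix

/-- For symmetric positive semidefinite matrices `A` and `B`,
`Tr((I + B)⁻¹ A) ≥ Tr(A) / (1 + Tr(B))`. -/
theorem trace_inv_one_add_mul_ge (p : ℕ) (A B : Matrix (Fin p) (Fin p) ℝ)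
    (hA : A.PosSemidef) (hB : B.PosSemidef) :
    (((1 : Matrix (Fin p) (Fin p) ℝ) + B)⁻¹ * A).trace ≥ A.trace / (1 + B.trace) := by
  obtain ⟨U, V, d, hVU, hUV, hBe, hd, ht, hV⟩ : ∃ (U V : Matrix (Fin p) (Fin p) ℝ) (d : Fin p → ℝ),
      V * U = 1 ∧ U * V = 1 ∧ B = U * diagonal d * V ∧ (∀ i, 0 ≤ d i) ∧ B.trace = ∑ i, d i
      ∧ V = Uᴴ := by
    refine ⟨hB.1.eigenvectorUnitary, star (hB.1.eigenvectorUnitary : Matrix (Fin p) (Fin p) ℝ),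
      hB.1.eigenvalues, ?_, ?_, ?_, hB.eigenvalues_nonneg, ?_, rfl⟩
    · simp
    · simp
    · have h := hB.1.spectral_theorem
      rw [Unitary.conjStarAlgAut_apply] at h
      exact h
    · simpa using hB.1.trace_eq_sum_eigenvalues
  have hinv : ((1 : Matrix (Fin p) (Fin p) ℝ) + B)⁻¹ = U * diagonal (fun i => (1 + d i)⁻¹) * V := by
    apply Matrix.inv_eq_right_inv
    have h1 : (1 : Matrix (Fin p) (Fin p) ℝ) + B = U * diagonal (fun i => 1 + d i) * V := by
      have : diagonal (fun i => 1 + d i) = (1 : Matrix (Fin p) (Fin p) ℝ) + diagonal d := by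
        rw [← diagonal_one, diagonal_add]
      rw [this, mul_add, add_mul, mul_one, hUV, hBe]
    have h2 : diagonal (fun i => 1 + d i) * diagonal (fun i => (1 + d i)⁻¹)
        = (1 : Matrix (Fin p) (Fin p) ℝ) := by
      rw [diagonal_mul_diagonal, ← diagonal_one]
      congr 1
      funext i
      exact mul_inv_cancel₀ (by linarith [hd i])
    calc _ = U * diagonal (fun i => 1 + d i) * (V * U) * diagonal (fun i => (1 + d i)⁻¹) * V := by
          rw [h1]; simp only [mul_assoc]
      _ = U * (diagonal (fun i => 1 + d i) * diagonal (fun i => (1 + d i)⁻¹)) * V := by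
          rw [hVU]; simp only [mul_assoc, one_mul]
      _ = 1 := by rw [h2, mul_one, hUV]
  have hC : (V * A * U).PosSemidef := by
    rw [hV]; exact hA.conjTranspose_mul_mul_same U
  have e1 : (((1 : Matrix (Fin p) (Fin p) ℝ) + B)⁻¹ * A).trace
      = ∑ i, (1 + d i)⁻¹ * (V * A * U) i i := by
    rw [hinv, mul_assoc, mul_assoc, trace_mul_comm, mul_assoc]
    simp only [trace, diag_apply, diagonal_mul]
  have e2 : A.trace = ∑ i, (V * A * U) i i := by
    change _ = (V * A * U).trace
    rw [trace_mul_comm, ← mul_assoc, hUV, one_mul]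
  rw [e1, e2, ht, ge_iff_le, Finset.sum_div]
  refine Finset.sum_le_sum fun i _ => ?_
  have hi : d i ≤ ∑ j, d j := Finset.single_le_sum (fun j _ => hd j) (Finset.mem_univ i)
  rw [div_eq_inv_mul]
  have h0 := hd i
  exact mul_le_mul_of_nonneg_right (inv_anti₀ (by linarith) (by linarith)) hC.diag_nonneg
end

section
/- Let n ≥ 1 and T ≥ 1 be integers, let Δ = { x ∈ ℝⁿ : x_i ≥ 0, Σ_i x_i = 1 } be the standard probability simplex, and let f : Δ → ℝ be convex and L-Lipschitz with respect to the ℓ1 norm (|f(x) − f(y)| ≤ L ‖x − y‖₁ for all x, y ∈ Δ) with L > 0. Set the step size η = (1/L)√(2 log n / T). Define the entropic mirror descent iterates by x_1 = (1/n, …, 1/n) and, for t = 1, …, T, let g_t ∈ ℝⁿ be a subgradient of f at x_t (i.e., f(y) ≥ f(x_t) + ⟨g_t, y − x_t⟩ for all y ∈ Δ, with ‖g_t‖_∞ ≤ L), and set x_{t+1, i} = x_{t,i} exp(−η g_{t,i}) / Σ_{j=1}^n x_{t,j} exp(−η g_{t,j}). Then min_{1 ≤ t ≤ T} f(x_t)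 − min_{x ∈ Δ} f(x) ≤ L √(2 log n / T). -/
open MeasureTheory ProbabilityTheory in
/-- Hoeffding's lemma for a finitely supported distribution. -/
lemma hoeffding_fin {n : ℕ} (p a : Fin n → ℝ) (hp : ∀ i, 0 ≤ p i) (hs : ∑ i, p i = 1)
    (L : ℝ) (hL : 0 < L) (ha : ∀ i, |a i| ≤ L) (s : ℝ) :
    ∑ i, p i * Real.exp (s * a i) ≤ Real.exp (s * ∑ i, p i * a i + s ^ 2 * L ^ 2 / 2) := by
  set μ : Measure (Fin n) := ∑ i, ENNReal.ofReal (p i) • Measure.dirac i with hμ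
  have hprob : IsProbabilityMeasure μ := by
    constructor
    simp only [hμ, Measure.coe_finset_sum, Finset.sum_apply, Measure.smul_apply, measure_univ,
      smul_eq_mul, mul_one]
    rw [← ENNReal.ofReal_sum_of_nonneg (fun i _ => hp i), hs, ENNReal.ofReal_one]
  have hint : ∀ F : Fin n → ℝ, ∫ i, F i ∂μ = ∑ i, p i * F i := by
    intro F
    rw [hμ, integral_finset_sum_measure (fun i _ => (Integrable.of_finite).smul_measure (by simp))]
    refine Finset.sum_congr rfl fun i _ => ?_
    rw [integral_smul_measure, integral_dirac, ENNReal.toReal_ofReal (hp i), smul_eq_mul]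
  have h := hasSubgaussianMGF_of_mem_Icc (μ := μ) (X := a) (a := -L) (b := L)
    (measurable_of_finite a).aemeasurable
    (Filter.Eventually.of_forall fun i => abs_le.mp (ha i))
  have h2 := h.mgf_le s
  rw [mgf, hint, hint] at h2
  have e1 : ∑ i, p i * Real.exp (s * (a i - ∑ i, p i * a i))
      = (∑ i, p i * Real.exp (s * a i)) * Real.exp (-(s * ∑ i, p i * a i)) := by
    rw [Finset.sum_mul]
    refine Finset.sum_congr rfl fun i _ => ?_
    rw [mul_assoc, ← Real.exp_add]
    congr 2
    ring
  have e2 : ((((‖L - -L‖₊ / 2) ^ 2 : NNReal) : ℝ)) = L ^ 2 := by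
    push_cast
    rw [Real.norm_eq_abs, abs_of_pos (by linarith)]
    ring
  rw [e1, e2] at h2
  have h3 := mul_le_mul_of_nonneg_right h2 (Real.exp_pos (s * ∑ i, p i * a i)).le
  rw [mul_assoc, ← Real.exp_add, ← Real.exp_add] at h3
  rw [neg_add_cancel, Real.exp_zero, mul_one] at h3
  refine h3.trans (le_of_eq ?_)
  congr 1
  ring

/-- Convergence of entropic mirror descent on the probability simplex: for a convex,
`L`-Lipschitz (w.r.t. ℓ1) function `f`, with step size `η = (1/L)√(2 log n / T)`,
`min_{1 ≤ t ≤ T} f(x_t) − min_{x ∈ Δ} f(x) ≤ L √(2 log n / T)`. -/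
theorem entropic_mirror_descent_convergence (n T : ℕ) (hn : 1 ≤ n) (hT : 1 ≤ T)
    (f : (Fin n → ℝ) → ℝ) (L : ℝ) (hL : 0 < L)
    (hconv : ConvexOn ℝ (stdSimplex ℝ (Fin n)) f)
    (hlip : ∀ x ∈ stdSimplex ℝ (Fin n), ∀ y ∈ stdSimplex ℝ (Fin n),
      |f x - f y| ≤ L * ∑ i, |x i - y i|)
    (η : ℝ) (hη : η = (1 / L) * Real.sqrt (2 * Real.log n / T))
    (x : ℕ → Fin n → ℝ) (g : ℕ → Fin n → ℝ)
    (hx1 : ∀ i, x 1 i = 1 / n)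
    (hsubgrad : ∀ t, 1 ≤ t → t ≤ T →
      (∀ y ∈ stdSimplex ℝ (Fin n), f y ≥ f (x t) + ∑ i, g t i * (y i - x t i)) ∧
      (∀ i, |g t i| ≤ L))
    (hupdate : ∀ t, 1 ≤ t → t ≤ T → ∀ i,
      x (t + 1) i = x t i * Real.exp (-η * g t i)
        / ∑ j, x t j * Real.exp (-η * g t j)) :
    ∀ y ∈ stdSimplex ℝ (Fin n),
      (Finset.Icc 1 T).inf' (Finset.nonempty_Icc.mpr hT) (fun t => f (x t))
        ≤ f y + L * Real.sqrt (2 * Real.log n / T) := by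

  intro y hy
  obtain ⟨hy0, hy1⟩ := hy
  have hn0 : (0 : ℝ) < n := by exact_mod_cast hn
  have hT0 : (0 : ℝ) < T := by exact_mod_cast hT
  haveI : Nonempty (Fin n) := ⟨⟨0, hn⟩⟩
  set S := Real.sqrt (2 * Real.log n / T) with hS
  have hlog : 0 ≤ Real.log n := Real.log_nonneg (by exact_mod_cast hn)
  have hS2 : S ^ 2 = 2 * Real.log n / T := Real.sq_sqrt (by positivity)
  have hS0 : 0 ≤ S := Real.sqrt_nonneg _
  set m := (Finset.Icc 1 T).inf' (Finset.nonempty_Icc.mpr hT) (fun t => f (x t)) with hm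
  have hmle : ∀ t, 1 ≤ t → t ≤ T → m ≤ f (x t) := fun t h1 h2 =>
    Finset.inf'_le (fun t => f (x t)) (Finset.mem_Icc.mpr ⟨h1, h2⟩)
  rcases Nat.lt_or_ge 1 n with h2n | hn1
  swap
  · have hn1' : n = 1 := le_antisymm hn1 hn
    subst hn1'
    have : x 1 = y := by
      funext i
      rw [hx1 i]
      rw [Fin.sum_univ_one] at hy1
      rw [Subsingleton.elim i 0, hy1]
      simp
    have h1 := hmle 1 le_rfl hT
    rw [this] at h1
    have : 0 ≤ L * S := by positivity
    linarith
  have hlogpos : 0 < Real.log n := Real.log_pos (by exact_mod_cast h2n)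
  have hSpos : 0 < S := Real.sqrt_pos.mpr (by positivity)
  have hηS : η * L = S := by rw [hη]; field_simp
  have hηpos : 0 < η := by rw [hη]; positivity
  -- the iterates are in the interior of the simplex
  have hpos : ∀ t, t ≤ T → (∀ i, 0 < x (t + 1) i) ∧ ∑ i, x (t + 1) i = 1 := by
    intro t
    induction t with
    | zero =>
      intro _
      constructor
      · intro i; rw [hx1 i]; positivity
      · simp only [zero_add, hx1]
        simp [hn0.ne']
    | succ k ih =>
      intro hk
      obtain ⟨ihp, ihs⟩ := ih (by omega)
      have hZ : 0 < ∑ j, x (k + 1) j * Real.exp (-η * g (k + 1) j) :=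
        Finset.sum_pos (fun j _ => mul_pos (ihp j) (Real.exp_pos _)) Finset.univ_nonempty
      constructor
      · intro i
        rw [hupdate (k + 1) (by omega) hk i]
        exact div_pos (mul_pos (ihp i) (Real.exp_pos _)) hZ
      · rw [Finset.sum_congr rfl fun i _ => hupdate (k + 1) (by omega) hk i]
        rw [← Finset.sum_div, div_self hZ.ne']
  have hmain : ∀ t, t ≤ T →
      -Real.log n + t * (η * (m - f y) - S ^ 2 / 2) ≤ ∑ i, y i * Real.log (x (t + 1) i) := by
    intro t
    induction t with
    | zero =>
      intro _
      simp only [zero_add, hx1]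
      rw [← Finset.sum_mul, hy1]
      simp
    | succ k ih =>
      intro hk
      have ih := ih (by omega)
      obtain ⟨ihp, ihs⟩ := hpos k (by omega)
      obtain ⟨hsg, hgL⟩ := hsubgrad (k + 1) (by omega) hk
      have hZ : 0 < ∑ j, x (k + 1) j * Real.exp (-η * g (k + 1) j) :=
        Finset.sum_pos (fun j _ => mul_pos (ihp j) (Real.exp_pos _)) Finset.univ_nonempty
      have hH := hoeffding_fin (x (k + 1)) (g (k + 1)) (fun i => (ihp i).le) ihs L hL hgL (-η)
      have hlZ := (Real.log_le_iff_le_exp hZ).mpr hH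
      set Z := ∑ j, x (k + 1) j * Real.exp (-η * g (k + 1) j) with hZdef
      have e : ∑ i, y i * Real.log (x (k + 1 + 1) i)
          = ∑ i, y i * Real.log (x (k + 1) i) - η * ∑ i, g (k + 1) i * y i - Real.log Z := by
        have : ∀ i, y i * Real.log (x (k + 1 + 1) i)
            = y i * Real.log (x (k + 1) i) - η * (g (k + 1) i * y i) - y i * Real.log Z := by
          intro i
          rw [hupdate (k + 1) (by omega) hk i, Real.log_div
            (mul_pos (ihp i) (Real.exp_pos _)).ne' hZ.ne',
            Real.log_mul (ihp i).ne' (Real.exp_pos _).ne', Real.log_exp]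
          ring
        rw [Finset.sum_congr rfl fun i _ => this i, Finset.sum_sub_distrib,
          Finset.sum_sub_distrib, ← Finset.sum_mul, ← Finset.mul_sum, hy1, one_mul]
      have hs1 := hsg y ⟨hy0, hy1⟩
      have e3 : ∑ i, g (k + 1) i * (y i - x (k + 1) i)
          = ∑ i, g (k + 1) i * y i - ∑ i, x (k + 1) i * g (k + 1) i := by
        rw [← Finset.sum_sub_distrib]
        exact Finset.sum_congr rfl fun i _ => by ring
      rw [e3] at hs1
      have hmk := hmle (k + 1) (by omega) hk
      have h5 : η * (m - f y) ≤
          η * (∑ i, x (k + 1) i * g (k + 1) i - ∑ i, g (k + 1) i * y i) :=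
        mul_le_mul_of_nonneg_left (by linarith) hηpos.le
      have h6 : (-η) ^ 2 * L ^ 2 = S ^ 2 := by rw [← hηS]; ring
      rw [h6] at hlZ
      rw [e]
      push_cast
      linarith
  have hfin := hmain T le_rfl
  obtain ⟨hp, hs⟩ := hpos T le_rfl
  have hle : ∑ i, y i * Real.log (x (T + 1) i) ≤ 0 := by
    refine Finset.sum_nonpos fun i _ => mul_nonpos_of_nonneg_of_nonpos (hy0 i) ?_
    refine Real.log_nonpos (hp i).le ?_
    rw [← hs]
    exact Finset.single_le_sum (fun j _ => (hp j).le) (Finset.mem_univ i)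
  have hlogn : Real.log n = T * (S ^ 2 / 2) := by rw [hS2]; field_simp
  have h7 : T * (η * (m - f y) - S ^ 2) ≤ 0 := by
    rw [hlogn] at hfin; linarith
  have h8 : η * (m - f y) - S ^ 2 ≤ 0 := by
    by_contra hc
    push Not at hc
    exact absurd (mul_pos hT0 hc) (not_lt.mpr h7)
  have h9 : η * (m - f y) ≤ η * (L * S) := by
    have : η * (L * S) = S ^ 2 := by rw [← mul_assoc, hηS]; ring
    linarith
  have := le_of_mul_le_mul_left h9 hηpos
  linarith
end
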